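/- arXiv:2403.03469 — 2 statements merged into one kernel-verified Lean document; each statement's English description precedes it below -/
import Mathlib

section
/- For every integer d ≥ 2 and every d×d complex matrix A, one has the expansion A = (1/d) · Σ_{q=0}^{d−1} Σ_{p=0}^{d−1} Tr(D_{q,p} A) · D_{q,p}^†. -/
open Matrix Complex

/-- `ω = exp(2πi/d)`. -/
noncomputable def omega (d : ℕ) : ℂ := Complex.exp (2 * Real.pi * Complex.I / d)

/-- The shift matrix `X` on `ℂ^d`, acting by `X|j⟩ = |j+1⟩` (indices mod `d`). -/
noncomputable def Xmat (d : ℕ) [NeZero d] : Matrix (ZMod d) (ZMod d) ℂ :=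
  Matrix.of fun i j => if i = j + 1 then 1 else 0

/-- The clock matrix `Z` on `ℂ^d`, acting by `Z|j⟩ = ω^j |j⟩`. -/
noncomputable def Zmat (d : ℕ) [NeZero d] : Matrix (ZMod d) (ZMod d) ℂ :=
  Matrix.diagonal fun j => omega d ^ (j.val)

/-- The displacement operator `D_{q,p} = e^{iπqp/d} X^q Z^p`. -/
noncomputable def Dmat (d : ℕ) [NeZero d] (q p : ℤ) : Matrix (ZMod d) (ZMod d) ℂ :=
  Complex.exp (Real.pi * Complex.I * q * p / d) • (Xmat d ^ q * Zmat d ^ p)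

lemma omega_pow_val (d : ℕ) [NeZero d] (j : ZMod d) :
    omega d ^ j.val = ZMod.stdAddChar j := by
  rw [omega, ← Complex.exp_nat_mul, ZMod.stdAddChar_apply, ZMod.toCircle_apply]
  congr 1
  ring

lemma Xmat_pow_apply (d : ℕ) [NeZero d] (n : ℕ) (i j : ZMod d) :
    (Xmat d ^ n) i j = if i = j + n then 1 else 0 := by
  induction n generalizing j with
  | zero => simp [Matrix.one_apply]
  | succ n ih =>
    rw [pow_succ, Matrix.mul_apply, Finset.sum_eq_single (j + 1)]
    · rw [ih]
      simp [Xmat, add_assoc, add_comm (1 : ZMod d)]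
    · intro k _ hk
      simp [Xmat, hk]
    · simp

lemma Dmat_val_apply (d : ℕ) [NeZero d] (q p i j : ZMod d) :
    Dmat d q.val p.val i j =
      Complex.exp (Real.pi * Complex.I * q.val * p.val / d) *
        (if i = j + q then ZMod.stdAddChar (j * p) else 0) := by
  have hZ : (ZMod.stdAddChar j : ℂ) ^ p.val = ZMod.stdAddChar (j * p) := by
    rw [← AddChar.map_nsmul_eq_pow, nsmul_eq_mul, ZMod.natCast_zmod_val, mul_comm]
  simp only [Dmat, zpow_natCast, Zmat, Matrix.diagonal_pow, Matrix.smul_apply,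
    Matrix.mul_diagonal, Xmat_pow_apply, ZMod.natCast_zmod_val, Pi.pow_apply, omega_pow_val,
    hZ, smul_eq_mul, ite_mul, one_mul, zero_mul, Int.cast_natCast]

lemma trace_Dmat_val_mul (d : ℕ) [NeZero d] (q p : ZMod d) (A : Matrix (ZMod d) (ZMod d) ℂ) :
    Matrix.trace (Dmat d q.val p.val * A) =
      Complex.exp (Real.pi * Complex.I * q.val * p.val / d) *
        ∑ j, ZMod.stdAddChar (j * p) * A j (j + q) := by
  rw [Matrix.trace_mul_comm, Matrix.trace, Finset.mul_sum]
  refine Finset.sum_congr rfl fun j _ => ?_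
  simp only [Matrix.diag_apply, Matrix.mul_apply, Dmat_val_apply]
  rw [Finset.sum_eq_single (j + q)]
  · simp only [if_true]
    ring
  · intro k _ hk
    simp [hk]
  · simp

lemma phase_mul_star (d q p : ℕ) :
    Complex.exp (Real.pi * Complex.I * q * p / d) *
      star (Complex.exp (Real.pi * Complex.I * q * p / d)) = 1 := by
  rw [Complex.star_def, ← Complex.exp_conj, ← Complex.exp_add]
  simp [neg_div]

lemma trace_smul_conjTranspose_Dmat_apply (d : ℕ) [NeZero d] (q p a b : ZMod d)
    (A : Matrix (ZMod d) (ZMod d) ℂ) :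
    (Matrix.trace (Dmat d q.val p.val * A) • (Dmat d q.val p.val)ᴴ) a b =
      if q = b - a then ∑ j, A j (j + q) * ZMod.stdAddChar (p * (j - a)) else 0 := by
  rw [Matrix.smul_apply, Matrix.conjTranspose_apply, trace_Dmat_val_mul, Dmat_val_apply, star_mul',
    smul_eq_mul, mul_mul_mul_comm, phase_mul_star, one_mul]
  by_cases h : q = b - a
  · have hb : b = a + q := by rw [h]; ring
    rw [if_pos h, if_pos hb, Finset.sum_mul]
    refine Finset.sum_congr rfl fun j _ => ?_
    have hs : star (ZMod.stdAddChar (a * p) : ℂ) = ZMod.stdAddChar (-(a * p)) :=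
      (AddChar.map_neg_eq_conj _ _).symm
    rw [hs, mul_right_comm, ← AddChar.map_add_eq_mul, mul_comm]
    ring_nf
  · have hb : ¬ b = a + q := fun hb => h (by rw [hb]; ring)
    simp [h, hb]

theorem displacement_expansion (d : ℕ) [NeZero d] (hd : 2 ≤ d)
    (A : Matrix (ZMod d) (ZMod d) ℂ) :
    A = (1 / (d : ℂ)) •
      ∑ q : ZMod d, ∑ p : ZMod d,
        Matrix.trace (Dmat d q.val p.val * A) • (Dmat d q.val p.val)ᴴ := by
  ext a b
  rw [Matrix.smul_apply]
  simp only [Matrix.sum_apply, trace_smul_conjTranspose_Dmat_apply]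
  have hd0 : (d : ℂ) ≠ 0 := NeZero.ne _
  rw [Finset.sum_eq_single (b - a) (fun q _ hq => by simp [hq]) (by simp)]
  simp only [if_true]
  rw [Finset.sum_comm]
  simp only [← Finset.mul_sum, AddChar.sum_mulShift _ (ZMod.isPrimitive_stdAddChar d), sub_eq_zero]
  simp [hd0, mul_comm]
end

section
/- Let d ≥ 1 and let U, V be unitary n×n complex matrices with U^d = V^d = I that do not commute (UV ≠ VU). Suppose there exist m ≥ 1 and unitary m×m complex matrices Ũ, Ṽ such that U ⊗ Ũ and V ⊗ Ṽ commute, where ⊗ denotes the Kronecker product. Then there exists a complex number α with α ≠ 1 and α^d = 1 such that U V U^{-1} V^{-1} = α · I; in particular U and V satisfy the defining relations of generators of the discrete Heisenberg group H(ℤ_d). -/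
open Matrix Kronecker

/-- Equal Kronecker products with nonzero second factor have proportional first factors. -/
theorem exists_eq_smul_of_kronecker_eq {K l p q r : Type*} [Field K]
    {A C : Matrix l p K} {B D : Matrix q r K} (hB : B ≠ 0) (h : A ⊗ₖ B = C ⊗ₖ D) :
    ∃ α : K, A = α • C := by
  obtain ⟨i, j, hij⟩ : ∃ i j, B i j ≠ 0 := by
    by_contra! hz
    exact hB (Matrix.ext hz)
  refine ⟨D i j / B i j, ?_⟩
  ext a b
  have hab := congrFun (congrFun h (a, i)) (b, j)
  simp only [kroneckerMap_apply] at hab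
  rw [Matrix.smul_apply, smul_eq_mul, div_mul_eq_mul_div, eq_div_iff hij, hab, mul_comm]

/-- A commutation relation up to a scalar passes to powers of the second element. -/
theorem mul_pow_eq_smul_of_mul_eq_smul {R A : Type*} [CommSemiring R] [Semiring A] [Algebra R A]
    {u v : A} {α : R} (h : u * v = α • (v * u)) (k : ℕ) :
    u * v ^ k = α ^ k • (v ^ k * u) := by
  induction k with
  | zero => simp
  | succ k ih =>
    rw [pow_succ, ← mul_assoc, ih, smul_mul_assoc, mul_assoc, h, mul_smul_comm, smul_smul,
      ← pow_succ, mul_assoc]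

theorem tensor_commuting_implies_heisenberg
    (n m d : ℕ) (hd : 1 ≤ d) (hm : 1 ≤ m)
    (U V : Matrix (Fin n) (Fin n) ℂ)
    (hU : U ∈ Matrix.unitaryGroup (Fin n) ℂ)
    (hV : V ∈ Matrix.unitaryGroup (Fin n) ℂ)
    (hUd : U ^ d = 1) (hVd : V ^ d = 1)
    (hnc : U * V ≠ V * U)
    (Ut Vt : Matrix (Fin m) (Fin m) ℂ)
    (hUt : Ut ∈ Matrix.unitaryGroup (Fin m) ℂ)
    (hVt : Vt ∈ Matrix.unitaryGroup (Fin m) ℂ)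
    (hcomm : (U ⊗ₖ Ut) * (V ⊗ₖ Vt) = (V ⊗ₖ Vt) * (U ⊗ₖ Ut)) :
    ∃ α : ℂ, α ≠ 1 ∧ α ^ d = 1 ∧ U * V * U⁻¹ * V⁻¹ = α • (1 : Matrix (Fin n) (Fin n) ℂ) := by
  have : Nonempty (Fin m) := ⟨⟨0, hm⟩⟩
  have hne : Ut * Vt ≠ 0 := by
    intro h0
    have h1 := mem_unitaryGroup_iff.mp (mul_mem hUt hVt)
    rw [h0, zero_mul] at h1
    exact zero_ne_one h1
  rw [← mul_kronecker_mul, ← mul_kronecker_mul] at hcomm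
  obtain ⟨α, hα⟩ := exists_eq_smul_of_kronecker_eq hne hcomm
  have hUu : IsUnit U.det := UnitaryGroup.det_isUnit ⟨U, hU⟩
  have hVu : IsUnit V.det := UnitaryGroup.det_isUnit ⟨V, hV⟩
  refine ⟨α, ?_, ?_, ?_⟩
  · rintro rfl
    exact hnc (by rw [hα, one_smul])
  · have hU0 : U ≠ 0 := by
      rintro rfl
      exact hnc (by simp)
    have hpow := mul_pow_eq_smul_of_mul_eq_smul hα d
    rw [hVd, mul_one, one_mul] at hpow
    exact smul_left_injective ℂ hU0 (by simpa using hpow.symm)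
  · rw [hα, smul_mul_assoc, smul_mul_assoc, mul_nonsing_inv_cancel_right _ _ hUu,
      mul_nonsing_inv _ hVu]
end
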